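/- arXiv:2103.03355 — 2 statements merged into one kernel-verified Lean document; each statement's English description precedes it below -/
import Mathlib

section
/- The integral over the real line ∫_{-∞}^{∞} log(−(y + i)²) · log(log y) / ( (y² + 1) · (log y)^{1/2} ) dy equals (1 − i) · √π · log 4 · log(iπ/2), where log denotes the principal branch of the complex logarithm and (log y)^{1/2} is the principal complex square root of log y. -/
open Complex MeasureTheory Real

lemma aux_P_int : Integrable (fun x : ℝ => (1 + x ^ 2) ^ (-(3 / 4) : ℝ)) := by
  have := integrable_rpow_neg_one_add_norm_sq (E := ℝ) (μ := volume) (r := 3 / 2)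
    (by rw [Module.finrank_self]; norm_num)
  refine this.congr (Filter.Eventually.of_forall fun x => ?_)
  simp only [Real.norm_eq_abs, sq_abs]
  norm_num

lemma aux_div_eq (x : ℝ) :
    (1 + x ^ 2) ^ (1 / 4 : ℝ) / (1 + x ^ 2) = (1 + x ^ 2) ^ (-(3 / 4) : ℝ) := by
  have h : 0 < 1 + x ^ 2 := by positivity
  rw [div_eq_mul_inv, ← Real.rpow_neg_one, ← Real.rpow_add h]
  norm_num

lemma aux_norm_den (x : ℝ) : ‖(x : ℂ) ^ 2 + 1‖ = 1 + x ^ 2 := by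
  have : (x : ℂ) ^ 2 + 1 = ((1 + x ^ 2 : ℝ) : ℂ) := by push_cast; ring
  rw [this, Complex.norm_real, Real.norm_of_nonneg (by positivity)]

lemma aux_decay {h : ℂ → ℂ} {C : ℝ} (hC : 0 ≤ C)
    (hb : ∀ z : ℂ, 0 ≤ z.im → ‖h z‖ ≤ C * (1 + ‖z‖ ^ 2) ^ (1 / 4 : ℝ))
    {R : ℝ} (hR : 2 ≤ R) {z : ℂ} (h0 : 0 ≤ z.im) (h1 : R ≤ ‖z‖) (h2 : ‖z‖ ≤ 2 * R) :
    ‖dslope h I z / (z + I)‖ ≤ (4 * C + 2 * ‖h I‖) * R ^ (1 / 2 : ℝ) / R ^ 2 := by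
  have hzI : z ≠ I := by
    rintro rfl
    rw [Complex.norm_I] at h1; linarith
  rw [dslope_of_ne _ hzI, slope_def_field, div_div]
  have hden : (z - I) * (z + I) = z ^ 2 + 1 := by ring_nf; simp; ring
  rw [hden, norm_div]
  have hd : R ^ 2 / 2 ≤ ‖z ^ 2 + 1‖ := by
    have := norm_sub_le (z ^ 2 + 1) 1
    simp only [add_sub_cancel_right, norm_pow, norm_one] at this
    nlinarith
  have hP : (1 + ‖z‖ ^ 2) ^ (1 / 4 : ℝ) ≤ 2 * R ^ (1 / 2 : ℝ) := by
    have e : 2 * R ^ (1 / 2 : ℝ) = (16 * R ^ 2) ^ (1 / 4 : ℝ) := by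
      rw [Real.mul_rpow (by norm_num) (by positivity), ← Real.rpow_natCast R 2,
        ← Real.rpow_mul (by linarith)]
      have : (16 : ℝ) = 2 ^ (4 : ℝ) := by norm_num
      rw [this, ← Real.rpow_mul (by norm_num)]
      norm_num
    rw [e]
    apply Real.rpow_le_rpow (by positivity) _ (by norm_num)
    nlinarith [norm_nonneg z]
  have h1R : 1 ≤ R ^ (1 / 2 : ℝ) := Real.one_le_rpow (by linarith) (by norm_num)
  have hn : ‖h z - h I‖ ≤ (2 * C + ‖h I‖) * R ^ (1 / 2 : ℝ) := by
    have := norm_sub_le (h z) (h I)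
    have := hb z h0
    nlinarith [norm_nonneg (h I), mul_le_mul_of_nonneg_left hP hC,
      mul_le_mul_of_nonneg_left h1R (norm_nonneg (h I))]
  calc _ ≤ ((2 * C + ‖h I‖) * R ^ (1 / 2 : ℝ)) / (R ^ 2 / 2) := by
        gcongr
    _ = _ := by field_simp; ring

lemma aux_halfplane {h : ℂ → ℂ} {C δ : ℝ} (hC : 0 ≤ C) (hδ : 0 < δ)
    (hd : DifferentiableOn ℂ h {z | -δ < z.im})
    (hb : ∀ z : ℂ, 0 ≤ z.im → ‖h z‖ ≤ C * (1 + ‖z‖ ^ 2) ^ (1 / 4 : ℝ)) :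
    Integrable (fun y : ℝ => h y / ((y : ℂ) ^ 2 + 1)) ∧
    ∫ y : ℝ, h y / ((y : ℂ) ^ 2 + 1) = π * h I := by
  have hopen : IsOpen {z : ℂ | -δ < z.im} := isOpen_lt continuous_const Complex.continuous_im
  have hne : ∀ y : ℝ, (y : ℂ) ^ 2 + 1 ≠ 0 := fun y => by
    rw [← norm_pos_iff, aux_norm_den]; positivity
  have hcont : Continuous (fun y : ℝ => h y / ((y : ℂ) ^ 2 + 1)) := by
    refine Continuous.div ?_ (by fun_prop) hne
    exact hd.continuousOn.comp_continuous Complex.continuous_ofReal (fun x => by simp [hδ])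
  have hint : Integrable (fun y : ℝ => h y / ((y : ℂ) ^ 2 + 1)) := by
    refine (aux_P_int.const_mul C).mono' hcont.aestronglyMeasurable
      (Filter.Eventually.of_forall fun x => ?_)
    rw [norm_div, aux_norm_den, ← aux_div_eq, ← mul_div_assoc]
    gcongr
    have := hb x (by simp)
    simpa using this
  have hinv : Integrable (fun y : ℝ => h I * ((1 + y ^ 2)⁻¹ : ℝ)) :=
    (integrable_inv_one_add_sq.ofReal).const_mul _
  set F : ℂ → ℂ := fun z => dslope h I z / (z + I) with hF
  have hFd : DifferentiableOn ℂ F {z | 0 ≤ z.im} := by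
    have h1 : DifferentiableOn ℂ (dslope h I) {z | -δ < z.im} :=
      (Complex.differentiableOn_dslope (hopen.mem_nhds (by simp; linarith))).2 hd
    refine DifferentiableOn.div (h1.mono fun z hz => ?_) (by fun_prop) ?_
    · simp only [Set.mem_ofPred_eq] at hz ⊢; linarith
    · intro z hz h0
      have := congrArg Complex.im h0
      simp at this hz; linarith
  have hFr : ∀ x : ℝ, F x = h x / ((x : ℂ) ^ 2 + 1) - h I * ((1 + x ^ 2)⁻¹ : ℝ) := by
    intro x
    have hxI : (x : ℂ) ≠ I := by
      intro h0
      have := congrArg Complex.im h0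
      simp at this
    have hden : ((x : ℂ) - I) * (x + I) = x ^ 2 + 1 := by ring_nf; simp; ring
    simp only [hF]
    rw [dslope_of_ne _ hxI, slope_def_field, div_div, hden]
    push_cast
    rw [sub_div, add_comm (1 : ℂ)]
    rfl
  have hFi : Integrable (fun x : ℝ => F x) := by
    simp_rw [hFr]; exact hint.sub hinv
  have hlim := intervalIntegral_tendsto_integral hFi Filter.tendsto_neg_atTop_atBot
    Filter.tendsto_id
  have hzero : Filter.Tendsto (fun R : ℝ => ∫ x in (-R)..R, F x) Filter.atTop (nhds 0) := by
    rw [tendsto_zero_iff_norm_tendsto_zero]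
    have ht : Filter.Tendsto (fun R : ℝ => (4 * (4 * C + 2 * ‖h I‖)) * R ^ (-(1 / 2) : ℝ))
        Filter.atTop (nhds 0) := by
      simpa using (tendsto_rpow_neg_atTop (y := 1 / 2) (by norm_num)).const_mul
        (4 * (4 * C + 2 * ‖h I‖))
    refine tendsto_of_tendsto_of_tendsto_of_le_of_le' tendsto_const_nhds ht
      (Filter.Eventually.of_forall fun _ => norm_nonneg _) ?_
    filter_upwards [Filter.eventually_ge_atTop 2] with R hR
    set K := (4 * C + 2 * ‖h I‖) * R ^ (1 / 2 : ℝ) / R ^ 2 with hK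
    have hR0 : 0 < R := by linarith
    have hrect := Complex.integral_boundary_rect_eq_zero_of_differentiableOn F (-R : ℂ) (R + R * I)
      (hFd.mono ?_)
    · simp only [neg_re, ofReal_re, neg_im, ofReal_im, add_re, mul_re, I_re, mul_zero, I_im,
        mul_one, sub_zero, add_im, mul_im, zero_add, add_zero, neg_zero, sub_self, ofReal_zero,
        zero_mul, smul_eq_mul] at hrect
      have b1 : ‖∫ x : ℝ in (-R)..R, F (x + R * I)‖ ≤ K * |R - -R| := by
        refine intervalIntegral.norm_integral_le_of_norm_le_const fun x hx => ?_
        rw [Set.uIoc_of_le (by linarith)] at hx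
        refine aux_decay hC hb hR (by simp; linarith) ?_ ?_
        · have := Complex.abs_im_le_norm ((x : ℂ) + R * I)
          simp only [add_im, ofReal_im, mul_im, ofReal_re, I_im, mul_one, I_re, mul_zero,
            add_zero, zero_add] at this
          exact (le_abs_self R).trans this
        · refine (Complex.norm_le_abs_re_add_abs_im _).trans ?_
          simp only [add_re, add_im, ofReal_re, ofReal_im, mul_re, mul_im, I_im, mul_one, I_re,
            mul_zero, add_zero, zero_add, sub_zero, sub_self]
          have := abs_le.2 ⟨hx.1.le, hx.2⟩
          rw [abs_of_pos hR0]; linarith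
      have b2 : ∀ s : ℝ, |s| = R → ‖∫ y : ℝ in (0)..R, F (s + y * I)‖ ≤ K * |R - 0| := by
        intro s hs
        refine intervalIntegral.norm_integral_le_of_norm_le_const fun x hx => ?_
        rw [Set.uIoc_of_le (by linarith)] at hx
        refine aux_decay hC hb hR (by simp; exact hx.1.le) ?_ ?_
        · have := Complex.abs_re_le_norm ((s : ℂ) + x * I)
          simp only [add_re, ofReal_im, mul_re, ofReal_re, I_im, mul_one, I_re, mul_zero,
            add_zero, sub_self] at this
          rwa [hs] at this
        · refine (Complex.norm_le_abs_re_add_abs_im _).trans ?_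
          simp only [add_re, add_im, ofReal_re, ofReal_im, mul_re, mul_im, I_im, mul_one, I_re,
            mul_zero, add_zero, zero_add, sub_zero, sub_self]
          have := abs_le.2 ⟨by linarith [hx.1], hx.2⟩
          rw [hs]; linarith
      have b3 := b2 R (abs_of_pos hR0)
      have b4 := b2 (-R) (by rw [abs_neg, abs_of_pos hR0])
      have e : ∫ x : ℝ in (-R)..R, F x = (∫ x : ℝ in (-R)..R, F (x + R * I)) -
          I * (∫ y : ℝ in (0)..R, F (R + y * I)) + I * (∫ y : ℝ in (0)..R, F ((-R : ℝ) + y * I)) := by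
        linear_combination hrect
      rw [e]
      refine (norm_add_le _ _).trans ?_
      have n1 := norm_sub_le (∫ x : ℝ in (-R)..R, F (x + R * I))
        (I * (∫ y : ℝ in (0)..R, F (R + y * I)))
      rw [norm_mul, Complex.norm_I, one_mul] at n1 ⊢
      have hKR : (4 * (4 * C + 2 * ‖h I‖)) * R ^ (-(1 / 2) : ℝ) = 4 * (K * R) := by
        have : R ^ (-(1 / 2) : ℝ) = R ^ (1 / 2 : ℝ) / R := by
          clear_value K
          rw [div_eq_mul_inv (R ^ (1 / 2 : ℝ)) R, ← Real.rpow_neg_one R, ← Real.rpow_add hR0]; congr 1; norm_num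
        rw [hK, this]; field_simp
      rw [hKR]
      rw [sub_neg_eq_add, abs_of_pos (by linarith)] at b1
      rw [sub_zero, abs_of_pos hR0] at b3 b4
      linarith
    · intro z hz
      rw [Complex.mem_reProdIm] at hz
      have := hz.2
      simp only [neg_im, ofReal_im, neg_zero, add_im, mul_im, ofReal_re, I_im, mul_one, I_re,
        mul_zero, add_zero, zero_add] at this
      rw [Set.uIcc_of_le hR0.le] at this
      exact this.1
  have hfin := tendsto_nhds_unique hlim hzero
  refine ⟨hint, ?_⟩
  simp_rw [hFr] at hfin
  have hpi : ∫ y : ℝ, (((1 + y ^ 2)⁻¹ : ℝ) : ℂ) = (π : ℂ) := by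
    rw [← integral_univ_inv_one_add_sq]
    exact integral_ofReal
  rw [integral_sub hint hinv, integral_const_mul, hpi] at hfin
  linear_combination hfin

noncomputable def auxf (z : ℂ) : ℂ :=
  2 * Complex.log (1 - I * z) *
    (Complex.log (Complex.log z) / Complex.exp (Complex.log (Complex.log z) / 2))

lemma aux_log_im_pos {z : ℂ} (hz : 0 < z.im) : 0 < (Complex.log z).im := by
  rw [Complex.log_im]
  refine lt_of_le_of_ne (Complex.arg_nonneg_iff.2 hz.le) (fun h => ?_)
  rw [eq_comm, Complex.arg_eq_zero_iff] at h
  linarith [h.2]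

lemma aux_log_im_nonneg {z : ℂ} (hz : 0 ≤ z.im) : 0 ≤ (Complex.log z).im := by
  rw [Complex.log_im]
  exact Complex.arg_nonneg_iff.2 hz

lemma aux_f_diff : DifferentiableOn ℂ auxf {z | 0 < z.im} := by
  intro z hz
  have hz : 0 < z.im := hz
  apply DifferentiableAt.differentiableWithinAt
  have h1 : 1 - I * z ∈ slitPlane := by
    left; simp; linarith
  have h2 : z ∈ slitPlane := Or.inr hz.ne'
  have h3 : Complex.log z ∈ slitPlane := Or.inr (aux_log_im_pos hz).ne'
  have d1 : DifferentiableAt ℂ (fun z => Complex.log (Complex.log z)) z :=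
    DifferentiableAt.clog (DifferentiableAt.clog differentiableAt_id h2) h3
  have d2 : DifferentiableAt ℂ (fun z => Complex.log (1 - I * z)) z :=
    DifferentiableAt.clog (by fun_prop) h1
  unfold auxf
  exact (d2.const_mul 2).mul (d1.div (d1.div_const 2).cexp (Complex.exp_ne_zero _))

lemma aux_norm_log (w : ℂ) : ‖Complex.log w‖ ≤ |Real.log ‖w‖| + 4 := by
  refine (Complex.norm_le_abs_re_add_abs_im _).trans ?_
  rw [Complex.log_re, Complex.log_im]
  have := Complex.abs_arg_le_pi w
  linarith [Real.pi_lt_four]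

lemma aux_real (s : ℝ) : (|s| + 4) / Real.exp (s / 2) ≤ 8 * (1 + Real.exp (-(3 / 4) * s)) := by
  rw [div_le_iff₀ (Real.exp_pos _)]
  have e : Real.exp (-(3 / 4) * s) * Real.exp (s / 2) = Real.exp (-s / 4) := by
    rw [← Real.exp_add]; congr 1; ring
  have h1 := Real.add_one_le_exp (s / 2)
  have h2 := Real.add_one_le_exp (-s / 4)
  have e2 : 8 * (1 + Real.exp (-(3 / 4) * s)) * Real.exp (s / 2) =
    8 * Real.exp (s / 2) + 8 * Real.exp (-s / 4) := by rw [← e]; ring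
  rw [e2]
  have := Real.exp_pos (s / 2)
  have := Real.exp_pos (-s / 4)
  rcases abs_cases s with ⟨h, h'⟩ | ⟨h, h'⟩ <;> rw [h] <;> linarith

lemma aux_phi {w : ℂ} (hw : w ≠ 0) :
    ‖Complex.log w / Complex.exp (Complex.log w / 2)‖ ≤ 8 * (1 + ‖w‖ ^ (-(3 / 4) : ℝ)) := by
  have hp : 0 < ‖w‖ := norm_pos_iff.2 hw
  rw [norm_div, Complex.norm_exp]
  have : (Complex.log w / 2).re = Real.log ‖w‖ / 2 := by
    rw [← Complex.log_re]; simp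
  rw [this, Real.rpow_def_of_pos hp, mul_comm (Real.log ‖w‖)]
  refine le_trans ?_ (aux_real _)
  gcongr
  exact aux_norm_log w

lemma aux_logz {z : ℂ} (hz : 0 < z.im) :
    ‖Complex.log z‖ ^ (-(3 / 4) : ℝ) ≤ 1 + 2 * ‖z - 1‖ ^ (-(3 / 4) : ℝ) := by
  have hz0 : z ≠ 0 := by rintro rfl; simp at hz
  have hz1 : 0 < ‖z - 1‖ := by
    rw [norm_pos_iff]
    intro h
    have := congrArg Complex.im h
    simp at this; linarith
  rcases le_total 1 ‖Complex.log z‖ with h | h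
  · have := Real.rpow_le_one_of_one_le_of_nonpos h (by norm_num : (-(3 / 4) : ℝ) ≤ 0)
    have : 0 ≤ ‖z - 1‖ ^ (-(3 / 4) : ℝ) := by positivity
    linarith
  · have h1 := Complex.norm_exp_sub_one_le h
    rw [Complex.exp_log hz0] at h1
    have h2 : ‖Complex.log z‖ ^ (-(3 / 4) : ℝ) ≤ (‖z - 1‖ / 2) ^ (-(3 / 4) : ℝ) :=
      Real.rpow_le_rpow_of_nonpos (by positivity) (by linarith) (by norm_num)
    have h3 : (‖z - 1‖ / 2) ^ (-(3 / 4) : ℝ) = ‖z - 1‖ ^ (-(3 / 4) : ℝ) * 2 ^ (3 / 4 : ℝ) := by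
      rw [Real.div_rpow hz1.le (by norm_num), Real.rpow_neg (by norm_num : (0:ℝ) ≤ 2), div_inv_eq_mul]
    have h4 : (2 : ℝ) ^ (3 / 4 : ℝ) ≤ 2 := by
      conv_rhs => rw [← Real.rpow_one 2]
      exact Real.rpow_le_rpow_of_exponent_le (by norm_num) (by norm_num)
    have : 0 ≤ ‖z - 1‖ ^ (-(3 / 4) : ℝ) := by positivity
    rw [h3] at h2
    nlinarith

lemma aux_log1 {z : ℂ} (hz : 0 < z.im) :
    ‖Complex.log (1 - I * z)‖ ≤ 12 * (1 + ‖z‖ ^ 2) ^ (1 / 4 : ℝ) := by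
  have h1 : 1 ≤ ‖1 - I * z‖ := by
    have := Complex.re_le_norm (1 - I * z)
    simp at this; linarith
  have h2 : ‖1 - I * z‖ ≤ 16 * (1 + ‖z‖ ^ 2) := by
    have := norm_sub_le 1 (I * z)
    simp at this
    nlinarith [sq_nonneg (‖z‖ - 1)]
  have h3 : ‖1 - I * z‖ ^ (1 / 4 : ℝ) ≤ 2 * (1 + ‖z‖ ^ 2) ^ (1 / 4 : ℝ) := by
    have : (2 : ℝ) = 16 ^ (1 / 4 : ℝ) := by
      have : (16 : ℝ) = 2 ^ (4 : ℝ) := by norm_num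
      rw [this, ← Real.rpow_mul (by norm_num)]
      norm_num
    calc _ ≤ (16 * (1 + ‖z‖ ^ 2)) ^ (1 / 4 : ℝ) :=
          Real.rpow_le_rpow (by positivity) h2 (by norm_num)
      _ = _ := by rw [Real.mul_rpow (by norm_num) (by positivity), ← this]
  have h4 : 1 ≤ (1 + ‖z‖ ^ 2) ^ (1 / 4 : ℝ) :=
    Real.one_le_rpow (by nlinarith [norm_nonneg z]) (by norm_num)
  have h5 := Real.log_le_rpow_div (norm_nonneg (1 - I * z)) (by norm_num : (0 : ℝ) < 1 / 4)
  have h6 := aux_norm_log (1 - I * z)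
  rw [abs_of_nonneg (Real.log_nonneg h1)] at h6
  linarith

lemma aux_f_bound {z : ℂ} (hz : 0 < z.im) :
    ‖auxf z‖ ≤ 400 * (1 + ‖z‖ ^ 2) ^ (1 / 4 : ℝ) * (1 + ‖z - 1‖ ^ (-(3 / 4) : ℝ)) := by
  have hw : Complex.log z ≠ 0 := by
    intro h
    have := aux_log_im_pos hz
    rw [h] at this; simp at this
  unfold auxf
  rw [norm_mul, norm_mul]
  have a := aux_log1 hz
  have b := aux_phi hw
  have c := aux_logz hz
  have n : 0 ≤ ‖z - 1‖ ^ (-(3 / 4) : ℝ) := by positivity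
  have n' : 0 ≤ (1 + ‖z‖ ^ 2) ^ (1 / 4 : ℝ) := by positivity
  have b' : ‖Complex.log (Complex.log z) / Complex.exp (Complex.log (Complex.log z) / 2)‖ ≤
    16 * (1 + ‖z - 1‖ ^ (-(3 / 4) : ℝ)) := by linarith
  calc _ ≤ (2 * (12 * (1 + ‖z‖ ^ 2) ^ (1 / 4 : ℝ))) * (16 * (1 + ‖z - 1‖ ^ (-(3 / 4) : ℝ))) := by
        rw [Complex.norm_two]
        gcongr
    _ ≤ _ := by nlinarith [mul_nonneg n n']

lemma aux_shift_bound {z : ℂ} (hz : 0 ≤ z.im) {e : ℝ} (he : 0 < e) (he1 : e ≤ 1) {d : ℝ}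
    (hd : 0 < d) (hd' : d ≤ ‖z + e * I - 1‖) :
    ‖auxf (z + e * I)‖ ≤ 800 * (1 + ‖z‖ ^ 2) ^ (1 / 4 : ℝ) * (1 + d ^ (-(3 / 4) : ℝ)) := by
  have h0 : 0 < (z + e * I).im := by simp; linarith
  refine (aux_f_bound h0).trans ?_
  have h1 : ‖z + e * I‖ ≤ ‖z‖ + 1 := by
    refine (norm_add_le _ _).trans ?_
    simp [abs_of_pos he, he1]
  have h2 : (1 + ‖z + e * I‖ ^ 2) ^ (1 / 4 : ℝ) ≤ 2 * (1 + ‖z‖ ^ 2) ^ (1 / 4 : ℝ) := by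
    have : (2 : ℝ) = 16 ^ (1 / 4 : ℝ) := by
      have : (16 : ℝ) = 2 ^ (4 : ℝ) := by norm_num
      rw [this, ← Real.rpow_mul (by norm_num)]
      norm_num
    calc _ ≤ (16 * (1 + ‖z‖ ^ 2)) ^ (1 / 4 : ℝ) := by
          refine Real.rpow_le_rpow (by positivity) ?_ (by norm_num)
          nlinarith [sq_nonneg (‖z‖ - 1), norm_nonneg (z + e * I), norm_nonneg z]
      _ = _ := by rw [Real.mul_rpow (by norm_num) (by positivity), ← this]
  have h3 : ‖z + e * I - 1‖ ^ (-(3 / 4) : ℝ) ≤ d ^ (-(3 / 4) : ℝ) :=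
    Real.rpow_le_rpow_of_nonpos hd hd' (by norm_num)
  calc _ ≤ 400 * (2 * (1 + ‖z‖ ^ 2) ^ (1 / 4 : ℝ)) * (1 + d ^ (-(3 / 4) : ℝ)) := by gcongr
    _ = _ := by ring

lemma aux_log_cont {w : ℂ} (hw : w ≠ 0) (h : 0 ≤ w.im) :
    ContinuousWithinAt Complex.log {z : ℂ | 0 ≤ z.im} w := by
  by_cases hs : w ∈ slitPlane
  · exact (continuousAt_clog hs).continuousWithinAt
  · rw [Complex.mem_slitPlane_iff] at hs
    push Not at hs
    refine Complex.continuousWithinAt_log_of_re_neg_of_im_zero ?_ hs.2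
    refine lt_of_le_of_ne hs.1 fun h0 => hw (Complex.ext h0 hs.2)

lemma aux_logR_ne {y : ℝ} (h0 : y ≠ 0) (h1 : y ≠ 1) : Complex.log y ≠ 0 := by
  intro h
  have := Complex.exp_log (x := (y : ℂ)) (by exact_mod_cast h0)
  rw [h, Complex.exp_zero] at this
  exact h1 (by exact_mod_cast this.symm)

lemma aux_f_cont {y : ℝ} (h0 : y ≠ 0) (h1 : y ≠ 1) :
    ContinuousWithinAt auxf {z : ℂ | 0 ≤ z.im} y := by
  have hy0 : (y : ℂ) ≠ 0 := by exact_mod_cast h0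
  have c1 := aux_log_cont hy0 (by simp)
  have c2 : ContinuousWithinAt (fun z => Complex.log (Complex.log z)) {z : ℂ | 0 ≤ z.im} y :=
    (aux_log_cont (aux_logR_ne h0 h1) (aux_log_im_nonneg (by simp))).comp c1
      (fun z hz => aux_log_im_nonneg hz)
  have c3 : ContinuousWithinAt (fun z => Complex.log (1 - I * z)) {z : ℂ | 0 ≤ z.im} y := by
    apply ContinuousAt.continuousWithinAt
    apply ContinuousAt.clog (by fun_prop)
    left; simp
  unfold auxf
  exact (c3.const_mul 2).mul (c2.div (c2.div_const 2).cexp (Complex.exp_ne_zero _))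

lemma aux_sing_int : Integrable ((Set.Icc (0 : ℝ) 2).indicator
    (fun y : ℝ => |y - 1| ^ (-(3 / 4) : ℝ))) := by
  rw [integrable_indicator_iff measurableSet_Icc]
  have h : LocallyIntegrable (fun y : ℝ => |y| ^ (-(3 / 4) : ℝ)) := by
    refine locallyIntegrable_of_norm_le_rpow (C := 1) (α := 3 / 4) (by simp) (by simp; norm_num)
      (Filter.Eventually.of_forall fun x => ?_) (Measurable.aestronglyMeasurable (by fun_prop))
    rw [Real.norm_of_nonneg (by positivity), one_mul, Real.norm_eq_abs]
  have h2 := (h.integrableOn_isCompact (isCompact_Icc (a := (-1 : ℝ)) (b := 1)))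
  have h3 := (measurePreserving_sub_right volume (1 : ℝ)).integrableOn_comp_preimage
    (MeasurableEquiv.subRight (1 : ℝ)).measurableEmbedding (f := fun y : ℝ => |y| ^ (-(3 / 4) : ℝ))
    (s := Set.Icc (-1) 1)
  have h4 := h3.2 h2
  have : (fun x : ℝ => x - 1) ⁻¹' Set.Icc (-1) 1 = Set.Icc 0 2 := by
    rw [Set.preimage_sub_const_Icc]; norm_num
  rw [this] at h4
  exact h4

lemma aux_dom {y e : ℝ} (h1 : y ≠ 1) (he : 0 < e) (he1 : e ≤ 1) :
    ‖auxf ((y : ℂ) + e * I) / ((y : ℂ) ^ 2 + 1)‖ ≤ 1600 * (1 + y ^ 2) ^ (-(3 / 4) : ℝ) +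
      800 * (Set.Icc (0 : ℝ) 2).indicator (fun y : ℝ => |y - 1| ^ (-(3 / 4) : ℝ)) y := by
  have hd : 0 < |y - 1| := abs_pos.2 (sub_ne_zero.2 h1)
  have hb := aux_shift_bound (z := y) (by simp) he he1 hd (by
    have := Complex.abs_re_le_norm ((y : ℂ) + e * I - 1)
    simpa using this)
  rw [Complex.norm_real, Real.norm_eq_abs, sq_abs] at hb
  rw [norm_div, aux_norm_den]
  have hq : (1 + y ^ 2) ^ (-(3 / 4) : ℝ) ≤ 1 :=
    Real.rpow_le_one_of_one_le_of_nonpos (by nlinarith [sq_nonneg y]) (by norm_num)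
  have hq0 : 0 ≤ (1 + y ^ 2) ^ (-(3 / 4) : ℝ) := by positivity
  have hp0 : 0 ≤ |y - 1| ^ (-(3 / 4) : ℝ) := by positivity
  have : ‖auxf ((y : ℂ) + e * I)‖ / (1 + y ^ 2) ≤
      800 * (1 + y ^ 2) ^ (-(3 / 4) : ℝ) * (1 + |y - 1| ^ (-(3 / 4) : ℝ)) := by
    calc _ ≤ 800 * (1 + y ^ 2) ^ (1 / 4 : ℝ) * (1 + |y - 1| ^ (-(3 / 4) : ℝ)) / (1 + y ^ 2) := by
          gcongr
      _ = _ := by rw [← aux_div_eq]; ring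
  refine this.trans ?_
  by_cases hy : y ∈ Set.Icc (0 : ℝ) 2
  · rw [Set.indicator_of_mem hy]
    nlinarith
  · rw [Set.indicator_of_notMem hy]
    have hge : 1 ≤ |y - 1| := by
      rw [Set.mem_Icc, not_and_or, not_le, not_le] at hy
      rcases hy with hy | hy
      · rw [abs_of_nonpos (by linarith)]; linarith
      · rw [abs_of_nonneg (by linarith)]; linarith
    have := Real.rpow_le_one_of_one_le_of_nonpos hge (by norm_num : (-(3 / 4) : ℝ) ≤ 0)
    nlinarith

lemma aux_shift {e : ℝ} (he : 0 < e) (he1 : e ≤ 1) :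
    Integrable (fun y : ℝ => auxf ((y : ℂ) + e * I) / ((y : ℂ) ^ 2 + 1)) ∧
    ∫ y : ℝ, auxf ((y : ℂ) + e * I) / ((y : ℂ) ^ 2 + 1) = π * auxf (I + e * I) := by
  refine aux_halfplane (h := fun z => auxf (z + e * I)) (C := 800 * (1 + e ^ (-(3 / 4) : ℝ)))
    (δ := e) (by positivity) he ?_ ?_
  · refine aux_f_diff.comp (by fun_prop) (fun z hz => ?_)
    simp only [Set.mem_ofPred_eq] at hz ⊢
    simp; linarith
  · intro z hz
    refine (aux_shift_bound hz he he1 he ?_).trans (le_of_eq (by ring))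
    have := Complex.im_le_norm (z + e * I - 1)
    simp at this
    linarith

lemma aux_main : ∫ y : ℝ, auxf y / ((y : ℂ) ^ 2 + 1) = π * auxf I := by
  set e : ℕ → ℝ := fun n => 1 / ((n : ℝ) + 1) with hedef
  have he : ∀ n, 0 < e n := fun n => by simp only [hedef]; positivity
  have he1 : ∀ n, e n ≤ 1 := fun n => by
    simp only [hedef]
    rw [div_le_one (by positivity)]
    linarith [(Nat.cast_nonneg n : (0 : ℝ) ≤ n)]
  have het : Filter.Tendsto e Filter.atTop (nhds 0) := tendsto_one_div_add_atTop_nhds_zero_nat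
  have hsh : ∀ z : ℂ, Filter.Tendsto (fun n => z + e n * I) Filter.atTop (nhds z) := by
    intro z
    have : Filter.Tendsto (fun n => (e n : ℂ)) Filter.atTop (nhds ((0 : ℝ) : ℂ)) :=
      (Complex.continuous_ofReal.tendsto 0).comp het
    simpa using (this.mul_const I).const_add z
  have hae0 : ∀ᵐ y : ℝ, y ≠ 0 := Measure.ae_ne volume 0
  have hae1 : ∀ᵐ y : ℝ, y ≠ 1 := Measure.ae_ne volume 1
  have hL : Filter.Tendsto (fun n => ∫ y : ℝ, auxf ((y : ℂ) + e n * I) / ((y : ℂ) ^ 2 + 1))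
      Filter.atTop (nhds (∫ y : ℝ, auxf y / ((y : ℂ) ^ 2 + 1))) := by
    refine tendsto_integral_of_dominated_convergence _
      (fun n => (aux_shift (he n) (he1 n)).1.aestronglyMeasurable)
      ((aux_P_int.const_mul 1600).add (aux_sing_int.const_mul 800)) (fun n => ?_) ?_
    · filter_upwards [hae1] with y hy
      exact aux_dom hy (he n) (he1 n)
    · filter_upwards [hae0, hae1] with y hy0 hy1
      refine Filter.Tendsto.div_const ?_ _
      refine (aux_f_cont hy0 hy1).tendsto.comp
        (tendsto_nhdsWithin_iff.2 ⟨hsh y, Filter.Eventually.of_forall fun n => ?_⟩)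
      simp [(he n).le]
  have hR : Filter.Tendsto (fun n => (π : ℂ) * auxf (I + e n * I)) Filter.atTop
      (nhds (π * auxf I)) := by
    refine Filter.Tendsto.const_mul _ ?_
    have : ContinuousAt auxf I := aux_f_diff.continuousOn.continuousAt
      ((isOpen_lt continuous_const Complex.continuous_im).mem_nhds (by simp))
    exact this.tendsto.comp (hsh I)
  refine tendsto_nhds_unique hL (hR.congr fun n => ?_)
  exact (aux_shift (he n) (he1 n)).2.symm

lemma aux_log_sq (y : ℝ) :
    Complex.log (-((y : ℂ) + I) ^ 2) = 2 * Complex.log (1 - I * y) := by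
  have hre : 0 < (1 - I * (y : ℂ)).re := by simp
  have hne : 1 - I * (y : ℂ) ≠ 0 := fun h => by rw [h] at hre; simp at hre
  have harg := abs_lt.1 (Complex.abs_arg_lt_pi_div_two_iff.2 (Or.inl hre))
  have e : -((y : ℂ) + I) ^ 2 = Complex.exp (2 * Complex.log (1 - I * y)) := by
    rw [two_mul, Complex.exp_add, Complex.exp_log hne]
    linear_combination (-(y : ℂ) ^ 2 - 1) * Complex.I_sq
  have him : (2 * Complex.log (1 - I * (y : ℂ))).im = 2 * Complex.arg (1 - I * y) := by
    rw [two_mul, Complex.add_im, Complex.log_im, two_mul]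
  rw [e, Complex.log_exp] <;> rw [him] <;> linarith [harg.1, harg.2]

lemma aux_logI : Complex.log (I * π / 2) = (Real.log (π / 2) : ℂ) + π / 2 * I := by
  have : I * (π : ℂ) / 2 = ((π / 2 : ℝ) : ℂ) * I := by push_cast; ring
  rw [this, Complex.log_ofReal_mul (by positivity) Complex.I_ne_zero, Complex.log_I]

lemma aux_value : π * auxf I =
    (1 - I) * (Real.sqrt π : ℂ) * Complex.log 4 * Complex.log (I * π / 2) := by
  have h2 : Complex.log 4 = 2 * Complex.log 2 := by
    have a : Complex.log 4 = (Real.log 4 : ℂ) := by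
      rw [Complex.ofReal_log (by norm_num)]; norm_num
    have b : Complex.log 2 = (Real.log 2 : ℂ) := by
      rw [Complex.ofReal_log (by norm_num)]; norm_num
    have c : Real.log 4 = 2 * Real.log 2 := by
      rw [show (4 : ℝ) = 2 ^ 2 by norm_num, Real.log_pow]; norm_num
    rw [a, b, c]; push_cast; ring
  have h1 : (1 : ℂ) - I * I = 2 := by rw [Complex.I_mul_I]; norm_num
  have hE : Complex.exp (Complex.log (I * π / 2) / 2) = (Real.sqrt π : ℂ) * (1 + I) / 2 := by
    rw [aux_logI, add_div, Complex.exp_add]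
    have e1 : Complex.exp ((Real.log (π / 2) : ℂ) / 2) = (Real.sqrt π : ℂ) / (Real.sqrt 2 : ℂ) := by
      rw [show ((Real.log (π / 2) : ℂ) / 2) = ((Real.log (π / 2) / 2 : ℝ) : ℂ) by push_cast; ring,
        ← Complex.ofReal_exp, Real.exp_half, Real.exp_log (by positivity),
        Real.sqrt_div' _ (by norm_num)]
      push_cast; rfl
    have e2 : Complex.exp ((π : ℂ) / 2 * I / 2) = (Real.sqrt 2 : ℂ) / 2 * (1 + I) := by
      rw [show (π : ℂ) / 2 * I / 2 = ((π / 4 : ℝ) : ℂ) * I by push_cast; ring, Complex.exp_mul_I,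
        ← Complex.ofReal_cos, ← Complex.ofReal_sin, Real.cos_pi_div_four, Real.sin_pi_div_four]
      push_cast; ring
    rw [e1, e2]
    have : (Real.sqrt 2 : ℂ) ≠ 0 := by
      rw [Complex.ofReal_ne_zero]; positivity
    field_simp
  have hlogI : Complex.log I = I * π / 2 := by rw [Complex.log_I]; ring
  unfold auxf
  rw [hlogI, h1, hE, h2]
  have hs : (Real.sqrt π : ℂ) ≠ 0 := by
    rw [Complex.ofReal_ne_zero]; positivity
  have hI : (1 + I) ≠ 0 := fun h => by
    have := congrArg Complex.re h
    simp at this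
  have hpi : (π : ℂ) = (Real.sqrt π : ℂ) * (Real.sqrt π : ℂ) := by
    rw [← Complex.ofReal_mul, Real.mul_self_sqrt Real.pi_pos.le]
  generalize Complex.log (I * π / 2) = L
  rw [hpi]
  field_simp
  ring_nf
  rw [Complex.I_sq]
  ring

theorem example_three :
    ∫ y : ℝ, Complex.log (-((y : ℂ) + I) ^ 2) * Complex.log (Complex.log y) /
        (((y : ℂ) ^ 2 + 1) * (Complex.log y) ^ ((1 : ℂ) / 2)) =
      (1 - I) * (Real.sqrt π : ℂ) * Complex.log 4 * Complex.log (I * π / 2) := by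
  rw [← aux_value, ← aux_main]
  refine integral_congr_ae ?_
  filter_upwards [Measure.ae_ne volume (0 : ℝ), Measure.ae_ne volume (1 : ℝ)] with y hy0 hy1
  rw [aux_log_sq, Complex.cpow_def_of_ne_zero (aux_logR_ne hy0 hy1), mul_one_div]
  unfold auxf
  rw [mul_div_assoc', div_div, mul_comm ((y : ℂ) ^ 2 + 1)]
end

section
/- The integral over the real line ∫_{-∞}^{∞} y · log(log y) / ( (1 − i y) · (y² + 1) · (log y)^{1/2} ) dy equals e^{iπ/4} · √(π/2) · log(iπ/2), where log denotes the principal branch of the complex logarithm and (log y)^{1/2} is the principal complex square root of log y. -/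
open Complex MeasureTheory Real
open Set Filter Topology

/-- The pole `iπ/2` of the transformed integrand. -/
noncomputable def pp : ℂ := I * π / 2
/-- `log w / sqrt w`. -/
noncomputable def gg (w : ℂ) : ℂ := Complex.log w * Complex.exp (-(1/2) * Complex.log w)
noncomputable def KK (w : ℂ) : ℂ :=
  I * Complex.exp w ^ 2 / ((Complex.exp w + I) ^ 2 * (Complex.exp w - I))
noncomputable def GG (w : ℂ) : ℂ := KK w * (gg w - gg pp)
noncomputable def BB (x : ℝ) : ℝ :=
  2 * Real.exp (-|x|) * (12 * (1 + |x| ^ (-(3/4) : ℝ)) + ‖gg pp‖)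

lemma gg_bound (w : ℂ) (hw : w.re ≠ 0) : ‖gg w‖ ≤ 12 * (1 + |w.re| ^ (-(3/4) : ℝ)) := by
  have hx : 0 < |w.re| := abs_pos.2 hw
  have hr : |w.re| ≤ ‖w‖ := Complex.abs_re_le_norm w
  have hr0 : 0 < ‖w‖ := hx.trans_le hr
  set u := Real.log ‖w‖ with hu
  set a := Real.exp (-u / 4) with ha
  have ha0 : 0 < a := Real.exp_pos _
  have e1 : ‖Complex.exp (-(1/2) * Complex.log w)‖ = a ^ 2 := by
    rw [Complex.norm_exp, ha, ← Real.exp_nat_mul]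
    congr 1
    have : (-(1/2) : ℂ) = ((-(1/2) : ℝ) : ℂ) := by push_cast; rfl
    rw [this, Complex.re_ofReal_mul, Complex.log_re, ← hu]
    push_cast; ring
  have e2 : ‖Complex.log w‖ ≤ |u| + 4 := by
    refine (Complex.norm_le_abs_re_add_abs_im _).trans ?_
    rw [Complex.log_re, Complex.log_im]
    have := Complex.abs_arg_le_pi w
    have := Real.pi_le_four
    linarith
  have e3 : |u| * a ≤ 4 * (a ^ 2 + 1) := by
    have h1 : u / 4 + 1 ≤ Real.exp (u / 4) := Real.add_one_le_exp _
    have h2 : -u / 4 + 1 ≤ a := Real.add_one_le_exp _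
    have h3 : Real.exp (u / 4) * a = 1 := by
      rw [ha, ← Real.exp_add]; ring_nf; simp
    have h4 := mul_le_mul_of_nonneg_right h1 ha0.le
    rw [h3] at h4
    rcases abs_cases u with ⟨h, _⟩ | ⟨h, _⟩ <;> rw [h] <;> nlinarith
  have e4 : a ^ 3 ≤ |w.re| ^ (-(3/4) : ℝ) := by
    rw [Real.rpow_def_of_pos hx, ha, ← Real.exp_nat_mul]
    apply Real.exp_le_exp.2
    have := Real.log_le_log hx hr
    push_cast
    linarith
  rw [gg, norm_mul, e1]
  have : ‖Complex.log w‖ * a ^ 2 ≤ (|u| + 4) * a ^ 2 := by gcongr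
  have : (|u| * a) * a ≤ 4 * (a ^ 2 + 1) * a := by gcongr
  have h5 : a ≤ 1 + a ^ 3 := by
    nlinarith [mul_nonneg ha0.le (sq_nonneg (a - 1)), sq_nonneg (a - 1), mul_nonneg (add_nonneg ha0.le zero_le_one) (sq_nonneg (a - 1))]
  have h6 : a ^ 2 ≤ 1 + a ^ 3 := by
    nlinarith [mul_nonneg ha0.le (sq_nonneg (a - 1)), sq_nonneg (a - 1), mul_nonneg (add_nonneg ha0.le zero_le_one) (sq_nonneg (a - 1))]
  nlinarith

lemma KK_bound (x y : ℝ) (h0 : 0 ≤ Real.sin y)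
    (h : Real.sin y ≤ 3/4 ∨ 1 ≤ |x|) : ‖KK (x + y * I)‖ ≤ 2 * Real.exp (-|x|) := by
  have hz : Complex.exp (x + y * I) = ((Real.exp x * Real.cos y : ℝ) : ℂ) + ((Real.exp x * Real.sin y : ℝ) : ℂ) * I := by
    rw [Complex.exp_add, Complex.exp_mul_I]; push_cast; ring
  set t := Real.exp x with ht
  have ht0 : 0 < t := Real.exp_pos _
  have hcs := Real.sin_sq_add_cos_sq y
  set s := Real.sin y
  set c := Real.cos y
  have n1 : ‖Complex.exp (x + y * I)‖ = t := by
    rw [Complex.norm_exp]; simp [ht]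
  have n2 : ‖Complex.exp (x + y * I) + I‖ ^ 2 = t ^ 2 + 2 * t * s + 1 := by
    rw [hz, ← Complex.normSq_eq_norm_sq, Complex.normSq_apply]
    simp
    linear_combination t ^ 2 * hcs
  have n3 : ‖Complex.exp (x + y * I) - I‖ ^ 2 = t ^ 2 - 2 * t * s + 1 := by
    rw [hz, ← Complex.normSq_eq_norm_sq, Complex.normSq_apply]
    simp
    linear_combination t ^ 2 * hcs
  have key : 2 * t * s ≤ 3/4 * (t ^ 2 + 1) := by
    rcases h with h | h
    · nlinarith [sq_nonneg (t - 1)]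
    · have hs : s ≤ 1 := Real.sin_le_one y
      have : 4/3 ≤ Real.cosh x := by
        have h1 : Real.cosh 1 ≤ Real.cosh x := Real.cosh_le_cosh.2 (by simpa using h)
        have h2 := Real.quadratic_le_exp_of_nonneg (x := 1) (by norm_num)
        have h3 := Real.add_one_le_exp (-1 : ℝ)
        have h4 : Real.exp 1 * Real.exp (-1) = 1 := by rw [← Real.exp_add]; simp
        have h5 := Real.exp_one_lt_d9
        rw [Real.cosh_eq] at h1
        nlinarith
      rw [Real.cosh_eq, Real.exp_neg, ← ht] at this
      have h3 : t * t⁻¹ = 1 := mul_inv_cancel₀ ht0.ne'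
      nlinarith
  have m : (t ^ 2 + 1) / 4 ≤ ‖Complex.exp (x + y * I) - I‖ ^ 2 := by rw [n3]; linarith
  set d := ‖Complex.exp (x + y * I) - I‖
  have d0 : 0 ≤ d := norm_nonneg _
  have d1 : 1 / 2 ≤ d := by nlinarith
  have d2 : t / 2 ≤ d := by nlinarith
  rw [KK, norm_div, norm_mul, norm_mul, norm_pow, norm_pow, n1, n2]
  simp only [Complex.norm_I, one_mul]
  have hts : 0 ≤ t * s := by positivity
  rw [div_le_iff₀ (by positivity)]
  rcases le_total 0 x with hx | hx
  · rw [abs_of_nonneg hx, Real.exp_neg, ← ht]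
    have h3 : t⁻¹ * t = 1 := inv_mul_cancel₀ ht0.ne'
    calc t ^ 2 ≤ 2 * t⁻¹ * ((t ^ 2) * (t / 2)) := by
          rw [show 2 * t⁻¹ * ((t ^ 2) * (t / 2)) = t ^ 2 * (t⁻¹ * t) by ring, h3, mul_one]
      _ ≤ _ := by gcongr; linarith
  · rw [abs_of_nonpos hx, neg_neg, ← ht]
    have : t ≤ 1 := by rw [ht]; exact Real.exp_le_one_iff.2 hx
    calc t ^ 2 ≤ 2 * t * (1 * (1 / 2)) := by nlinarith
      _ ≤ _ := by gcongr; nlinarith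

lemma GG_bound (x y : ℝ) (hx : x ≠ 0) (h0 : 0 ≤ Real.sin y)
    (h : Real.sin y ≤ 3/4 ∨ 1 ≤ |x|) : ‖GG (x + y * I)‖ ≤ BB x := by
  have h1 := KK_bound x y h0 h
  have h2 := gg_bound (x + y * I) (by simpa using hx)
  simp at h2
  rw [GG, BB, norm_mul]
  have h3 := norm_sub_le (gg (x + y * I)) (gg pp)
  gcongr
  linarith

lemma BB_integrable : Integrable BB := by
  have key : ∀ s : ℝ, 0 < s → Integrable (fun x : ℝ => Real.exp (-|x|) * |x| ^ (s - 1)) := by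
    intro s hs
    have h := Real.GammaIntegral_convergent hs
    have h1 : IntegrableOn (fun x : ℝ => Real.exp (-|x|) * |x| ^ (s - 1)) (Ioi 0) := by
      refine h.congr_fun (fun x hx => ?_) measurableSet_Ioi
      simp only [abs_of_pos (mem_Ioi.1 hx)]
    have h2 : IntegrableOn (fun x : ℝ => Real.exp (-|x|) * |x| ^ (s - 1)) (Iio 0) := by
      have := (integrable_indicator_iff measurableSet_Ioi).2 h1
      have := this.comp_neg
      rw [← integrable_indicator_iff measurableSet_Iio]
      refine this.congr (Eventually.of_forall fun x => ?_)
      simp [indicator]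
    rw [← integrableOn_univ, ← Iic_union_Ioi (a := (0:ℝ)), integrableOn_union]
    exact ⟨(integrableOn_Iic_iff_integrableOn_Iio).2 h2, h1⟩
  have a1 := key 1 one_pos
  have a2 := key (1/4) (by norm_num)
  have := (a1.const_mul (2 * (12 + ‖gg pp‖))).add (a2.const_mul 24)
  refine this.congr (Eventually.of_forall fun x => ?_)
  simp only [BB, Pi.add_apply]
  norm_num
  ring

lemma BB_tendsto : Tendsto BB atTop (𝓝 0) := by
  have h1 : Tendsto (fun x : ℝ => 2 * Real.exp (-x) * (12 * (1 + x ^ (-(3/4) : ℝ)) + ‖gg pp‖)) atTop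
      (𝓝 (2 * 0 * (12 * (1 + 0) + ‖gg pp‖))) := by
    refine ((Real.tendsto_exp_neg_atTop_nhds_zero).const_mul 2).mul ?_
    exact (((tendsto_rpow_neg_atTop (by norm_num)).const_add 1).const_mul 12).add_const _
  simp only [mul_zero, zero_mul] at h1
  refine h1.congr' ?_
  filter_upwards [eventually_ge_atTop 0] with x hx
  rw [BB, abs_of_nonneg hx]

lemma GG_measurable : Measurable GG := by
  unfold GG KK gg
  fun_prop

lemma GG_integrable (y : ℝ) (h0 : 0 ≤ Real.sin y) (h : Real.sin y ≤ 3/4) :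
    Integrable (fun x : ℝ => GG (x + y * I)) := by
  refine BB_integrable.mono' (GG_measurable.comp (by fun_prop)).aestronglyMeasurable ?_
  have : ∀ᵐ x : ℝ, x ≠ 0 := by simp [ae_iff]
  filter_upwards [this] with x hx
  exact GG_bound x y hx h0 (Or.inl h)

/-- The holomorphic extension of `GG` across the pole. -/
noncomputable def HH (w : ℂ) : ℂ :=
  I * Complex.exp w ^ 2 / (Complex.exp w + I) ^ 2 * (dslope gg pp w / dslope Complex.exp pp w)

lemma exp_pp : Complex.exp pp = I := by
  rw [pp, show I * (π:ℂ) / 2 = (π / 2) * I by ring, Complex.exp_pi_div_two_mul_I]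

lemma strip_exp (w : ℂ) (h1 : 0 < w.im) (h2 : w.im ≤ π) (h : Complex.exp w = I) : w = pp := by
  have : w = Complex.log (Complex.exp w) := (Complex.log_exp (by linarith [Real.pi_pos]) h2).symm
  rw [this, h, Complex.log_I, pp]; ring

lemma strip_exp_add (w : ℂ) (h1 : 0 ≤ w.im) (h2 : w.im ≤ π) : Complex.exp w + I ≠ 0 := by
  intro h
  have := congrArg Complex.im h
  simp [Complex.exp_im] at this
  have h3 := mul_nonneg (Real.exp_pos w.re).le (Real.sin_nonneg_of_nonneg_of_le_pi h1 h2)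
  linarith

lemma HH_eq (w : ℂ) (hw : w ≠ pp) : HH w = GG w := by
  rw [HH, GG, KK, dslope_of_ne _ hw, dslope_of_ne _ hw, slope, slope, exp_pp]
  simp only [vsub_eq_sub, smul_eq_mul]
  have : w - pp ≠ 0 := sub_ne_zero.2 hw
  rw [mul_div_mul_left _ _ (inv_ne_zero this), div_mul_div_comm, div_mul_eq_mul_div]

lemma gg_diff : DifferentiableOn ℂ gg {w | 0 < w.im} := by
  intro w hw
  have hs : w ∈ slitPlane := by
    rw [Complex.mem_slitPlane_iff]; right; exact (ne_of_gt hw)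
  have := (differentiableAt_log hs)
  unfold gg
  exact (this.mul ((this.const_mul _).cexp)).differentiableWithinAt

lemma HH_diff : DifferentiableOn ℂ HH {w | 0 < w.im ∧ w.im ≤ π} := by
  have ho : IsOpen {w : ℂ | 0 < w.im} := isOpen_lt continuous_const Complex.continuous_im
  have hp : {w : ℂ | 0 < w.im} ∈ 𝓝 pp := ho.mem_nhds (by simp [pp]; positivity)
  have d1 := (Complex.differentiableOn_dslope hp).2 gg_diff
  have d2 : DifferentiableOn ℂ (dslope Complex.exp pp) univ :=
    (Complex.differentiableOn_dslope univ_mem).2 Complex.differentiable_exp.differentiableOn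
  unfold HH
  refine DifferentiableOn.mul (DifferentiableOn.div (by fun_prop) (by fun_prop) ?_)
    (DifferentiableOn.div (d1.mono fun w h => h.1) (d2.mono (subset_univ _)) ?_)
  · intro w hw
    exact pow_ne_zero _ (strip_exp_add w hw.1.le hw.2)
  · intro w hw
    by_cases h : w = pp
    · rw [h, dslope_same, Complex.deriv_exp]; exact Complex.exp_ne_zero _
    · rw [dslope_of_ne _ h, slope, exp_pp]
      simp only [vsub_eq_sub, smul_eq_mul]
      exact mul_ne_zero (inv_ne_zero (sub_ne_zero.2 h))
        (sub_ne_zero.2 fun hq => h (strip_exp w hw.1 hw.2 hq))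

lemma shift_eq (ε : ℝ) (h0 : 0 < ε) (h1 : ε < π / 2) (h2 : Real.sin ε ≤ 3/4) :
    ∫ x : ℝ, GG (x + ε * I) = ∫ x : ℝ, GG (x + (π : ℝ) * I) := by
  have hpi := Real.pi_pos
  have ppre : pp.re = 0 := by simp [pp]
  have ppim : pp.im = π / 2 := by simp [pp]
  have s0 : 0 ≤ Real.sin ε := Real.sin_nonneg_of_nonneg_of_le_pi h0.le (by linarith)
  have rect : ∀ R : ℝ, 1 ≤ R → (∫ x : ℝ in -R..R, GG (x + ε * I)) - (∫ x : ℝ in -R..R, GG (x + (π : ℝ) * I))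
      + I • (∫ y : ℝ in ε..π, GG (R + y * I)) - I • (∫ y : ℝ in ε..π, GG ((-R : ℝ) + y * I)) = 0 := by
    intro R hR
    have := Complex.integral_boundary_rect_eq_zero_of_differentiableOn HH ((-R : ℝ) + ε * I) (R + π * I) ?_
    · simp only [add_re, ofReal_re, mul_re, I_re, mul_zero, ofReal_im, I_im, mul_one, sub_self, add_zero, add_im, mul_im, zero_add] at this
      have e1 : ∀ x : ℝ, HH (x + ε * I) = GG (x + ε * I) := fun x => HH_eq _ fun h => by
        have := congrArg Complex.im h
        rw [ppim] at this
        simp at this; linarith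
      have e2 : ∀ x : ℝ, HH (x + (π : ℝ) * I) = GG (x + (π : ℝ) * I) := fun x => HH_eq _ fun h => by
        have := congrArg Complex.im h
        rw [ppim] at this
        simp at this; linarith
      have e3 : ∀ (r : ℝ) (y : ℝ), r ≠ 0 → HH (r + y * I) = GG (r + y * I) := fun r y hr => HH_eq _ fun h => by
        have := congrArg Complex.re h
        rw [ppre] at this
        simp at this; exact hr this
      simp only [e1, e2, fun y => e3 R y (by linarith), fun y => e3 (-R) y (by linarith)] at this
      exact this
    · refine HH_diff.mono fun w hw => ?_
      rw [Complex.mem_reProdIm] at hw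
      have := hw.2
      simp at this
      rw [uIcc_of_le (by linarith)] at this
      exact ⟨h0.trans_le this.1, this.2⟩
  have i1 := GG_integrable ε s0 h2
  have i2 := GG_integrable π (by simp) (by simp; norm_num)
  have t1 := intervalIntegral_tendsto_integral i1 tendsto_neg_atTop_atBot tendsto_id
  have t2 := intervalIntegral_tendsto_integral i2 tendsto_neg_atTop_atBot tendsto_id
  have tv : ∀ σ : ℝ, |σ| = 1 → Tendsto (fun R : ℝ => ∫ y : ℝ in ε..π, GG ((σ * R : ℝ) + y * I)) atTop (𝓝 0) := by
    intro σ hσ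
    have hB : Tendsto (fun R => BB R * |π - ε|) atTop (𝓝 0) := by
      simpa using BB_tendsto.mul_const |π - ε|
    refine squeeze_zero_norm' ?_ hB
    filter_upwards [eventually_ge_atTop 1] with R hR
    refine intervalIntegral.norm_integral_le_of_norm_le_const fun y hy => ?_
    rw [uIoc_of_le (by linarith)] at hy
    have ha : |σ * R| = R := by rw [abs_mul, hσ, one_mul, abs_of_nonneg (by linarith)]
    have hb : BB (σ * R) = BB R := by rw [BB, BB, ha, abs_of_nonneg (by linarith : (0:ℝ) ≤ R)]
    rw [← hb]
    refine GG_bound _ _ ?_ (Real.sin_nonneg_of_nonneg_of_le_pi (h0.le.trans hy.1.le) hy.2) (Or.inr (by rw [ha]; exact hR))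
    intro h; rw [h] at ha; simp at ha; linarith
  have v1 := tv 1 (by simp)
  have v2 := tv (-1) (by simp)
  have T := ((t1.sub t2).add (v1.const_smul I)).sub (v2.const_smul I)
  have Tz := T.congr' (f₂ := fun _ => (0:ℂ)) (by
    filter_upwards [eventually_ge_atTop 1] with R hR
    have := rect R hR
    simpa using this)
  have := tendsto_nhds_unique Tz tendsto_const_nhds
  simp at this
  exact sub_eq_zero.1 this

lemma log_lim (x : ℝ) (hx : x ≠ 0) :
    Tendsto (fun ε : ℝ => Complex.log (x + ε * I)) (𝓝[>] 0) (𝓝 (Complex.log x)) := by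
  have h : ContinuousWithinAt Complex.log {z : ℂ | 0 ≤ z.im} (x : ℂ) := by
    rcases lt_or_gt_of_ne hx with h | h
    · exact Complex.continuousWithinAt_log_of_re_neg_of_im_zero (by simpa using h) (by simp)
    · exact (continuousAt_clog (by simp [Complex.mem_slitPlane_iff, h])).continuousWithinAt
  refine h.tendsto.comp (tendsto_nhdsWithin_iff.2 ⟨?_, ?_⟩)
  · have : ContinuousAt (fun ε : ℝ => (x + ε * I : ℂ)) 0 := by fun_prop
    have := this.tendsto
    simp at this
    exact this.mono_left nhdsWithin_le_nhds
  · filter_upwards [self_mem_nhdsWithin] with ε hε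
    simpa using le_of_lt hε

lemma boundary_eq : ∫ x : ℝ, GG x = ∫ x : ℝ, GG (x + (π : ℝ) * I) := by
  have hs : ∀ᶠ ε : ℝ in 𝓝[>] 0, 0 < ε ∧ ε < π / 2 ∧ Real.sin ε ≤ 3/4 := by
    have a : ∀ᶠ ε : ℝ in 𝓝[>] 0, ε ∈ Ioo (0:ℝ) (1/2) := Ioo_mem_nhdsGT (by norm_num)
    filter_upwards [a] with ε hε
    have := Real.pi_gt_three
    refine ⟨hε.1, by linarith [hε.2], ?_⟩
    linarith [Real.sin_le hε.1.le, hε.2]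
  have T : Tendsto (fun ε : ℝ => ∫ x : ℝ, GG (x + ε * I)) (𝓝[>] 0) (𝓝 (∫ x : ℝ, GG x)) := by
    have hne : ∀ᵐ x : ℝ, x ≠ 0 := by simp [ae_iff]
    refine tendsto_integral_filter_of_dominated_convergence BB ?_ ?_ BB_integrable ?_
    · exact Eventually.of_forall fun ε => (GG_measurable.comp (by fun_prop)).aestronglyMeasurable
    · filter_upwards [hs] with ε hε
      filter_upwards [hne] with x hx
      exact GG_bound x ε hx (Real.sin_nonneg_of_nonneg_of_le_pi hε.1.le (by linarith [hε.2.1, Real.pi_pos])) (Or.inl hε.2.2)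
    · filter_upwards [hne] with x hx
      have hl := log_lim x hx
      have hg : Tendsto (fun ε : ℝ => gg (x + ε * I)) (𝓝[>] 0) (𝓝 (gg x)) := by
        unfold gg
        exact hl.mul ((hl.const_mul _).cexp)
      have hk : Tendsto (fun ε : ℝ => KK (x + ε * I)) (𝓝[>] 0) (𝓝 (KK x)) := by
        have hc : ContinuousAt (fun ε : ℝ => KK (x + ε * I)) 0 := by
          unfold KK
          refine ContinuousAt.div (by fun_prop) (by fun_prop) ?_
          refine mul_ne_zero (pow_ne_zero _ (strip_exp_add _ (by simp) (by simp; positivity))) ?_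
          intro h
          have := congrArg Complex.im h
          simp [Complex.exp_im] at this
        have := hc.tendsto
        simp only [ofReal_zero, zero_mul, add_zero] at this
        exact this.mono_left nhdsWithin_le_nhds
      exact hk.mul (hg.sub_const _)
  refine tendsto_nhds_unique T (tendsto_const_nhds.congr' ?_)
  filter_upwards [hs] with ε hε
  exact (shift_eq ε hε.1 hε.2.1 hε.2.2).symm

noncomputable def PP (y : ℝ) : ℂ := (y : ℂ) / ((1 - I * y) * ((y : ℂ) ^ 2 + 1))

noncomputable def FF (y : ℝ) : ℂ := (y : ℂ) * Complex.log (Complex.log y) /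
        ((1 - I * y) * ((y : ℂ) ^ 2 + 1) * (Complex.log y) ^ ((1 : ℂ) / 2))

lemma one_sub_ne (y : ℝ) : (1 - I * y : ℂ) ≠ 0 := by
  intro h
  have := congrArg Complex.re h
  simp at this

lemma sq_add_ne (y : ℝ) : ((y : ℂ) ^ 2 + 1) ≠ 0 := by
  have : (y ^ 2 + 1 : ℝ) ≠ 0 := by positivity
  exact_mod_cast this

lemma PP_eq (y : ℝ) : PP y = ((y / (1 + y ^ 2) ^ 2 : ℝ) : ℂ) + ((y ^ 2 / (1 + y ^ 2) ^ 2 : ℝ) : ℂ) * I := by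
  have h1 := one_sub_ne y
  have h2 := sq_add_ne y
  have h3 : (1 + (y : ℂ) ^ 2) ≠ 0 := by rwa [add_comm]
  rw [PP]
  push_cast
  rw [div_mul_eq_mul_div, ← add_div, div_eq_div_iff (mul_ne_zero h1 h2) (pow_ne_zero _ h3)]
  have hI : I ^ 2 = -1 := Complex.I_sq
  linear_combination (-(y : ℂ)^3 * (-(y:ℂ)^2 - 1)) * hI

lemma PP_integrable : Integrable PP := by
  have hm : Measurable PP := by unfold PP; fun_prop
  refine integrable_inv_one_add_sq.mono' hm.aestronglyMeasurable (Eventually.of_forall fun y => ?_)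
  have h1 : |y| ≤ ‖(1 - I * y : ℂ)‖ := by
    have := Complex.abs_im_le_norm (1 - I * y : ℂ)
    simpa using this
  have h2 : ‖((y : ℂ) ^ 2 + 1)‖ = 1 + y ^ 2 := by
    rw [show ((y : ℂ) ^ 2 + 1) = ((1 + y ^ 2 : ℝ) : ℂ) by push_cast; ring, Complex.norm_real,
      Real.norm_of_nonneg (by positivity)]
  rw [PP, norm_div, norm_mul, h2, Complex.norm_real, Real.norm_eq_abs, ← div_div, inv_eq_one_div]
  gcongr
  exact div_le_one_of_le₀ h1 (norm_nonneg _)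

lemma PP_integral : ∫ y, PP y = I * π / 2 := by
  have hd : ∀ y : ℝ, HasDerivAt (fun y : ℝ => ((-(1 + y ^ 2)⁻¹ / 2 : ℝ) : ℂ)
      + (((Real.arctan y - y * (1 + y ^ 2)⁻¹) / 2 : ℝ) : ℂ) * I) (PP y) y := by
    intro y
    have h0 : (1 + y ^ 2) ≠ 0 := by positivity
    have hq : HasDerivAt (fun y : ℝ => (1 + y ^ 2)⁻¹) (-(2 * y) / (1 + y ^ 2) ^ 2) y := by
      have := (((hasDerivAt_id y).pow 2).const_add 1).inv h0
      refine HasDerivAt.congr_deriv (f := fun y : ℝ => (1 + y ^ 2)⁻¹) this ?_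
      simp
    have d1 : HasDerivAt (fun y : ℝ => -(1 + y ^ 2)⁻¹ / 2) (y / (1 + y ^ 2) ^ 2) y := by
      refine (hq.neg.div_const 2).congr_deriv ?_
      field_simp
    have d2 : HasDerivAt (fun y : ℝ => (Real.arctan y - y * (1 + y ^ 2)⁻¹) / 2) (y ^ 2 / (1 + y ^ 2) ^ 2) y := by
      refine (((Real.hasDerivAt_arctan y).sub ((hasDerivAt_id y).mul hq)).div_const 2).congr_deriv ?_
      simp only [id]
      field_simp
      ring
    rw [PP_eq]
    exact d1.ofReal_comp.add (d2.ofReal_comp.mul_const I)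
  have hb : ∀ y : ℝ, 1 ≤ |y| → |(1 + y ^ 2)⁻¹| ≤ |y|⁻¹ ∧ |y * (1 + y ^ 2)⁻¹| ≤ |y|⁻¹ := by
    intro y hy
    have h1 : |(1 + y ^ 2)⁻¹| = (1 + y ^ 2)⁻¹ := abs_of_nonneg (by positivity)
    have h2 : y ^ 2 = |y| ^ 2 := (sq_abs y).symm
    rw [abs_mul, h1, h2]
    constructor
    · apply inv_anti₀ (by linarith); nlinarith
    · rw [← div_eq_mul_inv, div_le_iff₀ (by positivity), ← div_eq_inv_mul, le_div_iff₀ (by linarith)]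
      nlinarith
  have lim : ∀ (l : Filter ℝ) (a : ℝ), Tendsto (fun y : ℝ => |y|) l atTop → Tendsto Real.arctan l (𝓝 a) →
      Tendsto (fun y : ℝ => ((-(1 + y ^ 2)⁻¹ / 2 : ℝ) : ℂ)
      + (((Real.arctan y - y * (1 + y ^ 2)⁻¹) / 2 : ℝ) : ℂ) * I) l (𝓝 (((-0 / 2 : ℝ) : ℂ) + (((a - 0) / 2 : ℝ) : ℂ) * I)) := by
    intro l a hl ha
    have hi := tendsto_inv_atTop_zero.comp hl
    have h1 : Tendsto (fun y : ℝ => (1 + y ^ 2)⁻¹) l (𝓝 0) := by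
      refine squeeze_zero_norm' ?_ hi
      filter_upwards [hl.eventually (eventually_ge_atTop 1)] with y hy using (hb y hy).1
    have h2 : Tendsto (fun y : ℝ => y * (1 + y ^ 2)⁻¹) l (𝓝 0) := by
      refine squeeze_zero_norm' ?_ hi
      filter_upwards [hl.eventually (eventually_ge_atTop 1)] with y hy using (hb y hy).2
    refine Tendsto.add ?_ (Tendsto.mul_const I ?_)
    · exact (Complex.continuous_ofReal.tendsto _).comp (h1.neg.div_const 2)
    · exact (Complex.continuous_ofReal.tendsto _).comp ((ha.sub h2).div_const 2)
  rw [integral_of_hasDerivAt_of_tendsto hd PP_integrable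
    (lim atBot _ tendsto_abs_atBot_atTop (Real.tendsto_arctan_atBot.mono_right nhdsWithin_le_nhds))
    (lim atTop _ tendsto_abs_atTop_atTop (Real.tendsto_arctan_atTop.mono_right nhdsWithin_le_nhds))]
  push_cast
  ring

lemma gg_eq (w : ℂ) (hw : w ≠ 0) : gg w = Complex.log w / w ^ ((1 : ℂ) / 2) := by
  rw [gg, Complex.cpow_def_of_ne_zero hw, div_eq_mul_inv (Complex.log w), ← Complex.exp_neg]
  congr 2; ring

/-- `FF - c PP`. -/
noncomputable def DD (y : ℝ) : ℂ := FF y - gg pp * PP y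

lemma DD_eq (y : ℝ) (w : ℂ) (hw : w ≠ 0) (h1 : Complex.log y = w) (h2 : Complex.exp w = y) :
    (y : ℂ) * DD y = GG w := by
  have a1 := one_sub_ne y
  have a2 := sq_add_ne y
  have hI : I ^ 2 = -1 := Complex.I_sq
  have e1 : FF y = PP y * gg w := by
    rw [FF, PP, gg_eq w hw, h1, div_mul_div_comm]
  have e2 : KK w = y * PP y := by
    rw [KK, PP, h2]
    have a3 : (y + I : ℂ) ≠ 0 := by
      intro h; have := congrArg Complex.im h; simp at this
    have a4 : (y - I : ℂ) ≠ 0 := by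
      intro h; have := congrArg Complex.im h; simp at this
    rw [mul_div_assoc', div_eq_div_iff (mul_ne_zero (pow_ne_zero _ a3) a4) (mul_ne_zero a1 a2)]
    have b1 : (y : ℂ) ^ 2 + 1 = (y + I) * (y - I) := by linear_combination hI
    have b2 : I * (1 - I * y) = y + I := by linear_combination -(y:ℂ) * hI
    rw [b1]
    linear_combination (y:ℂ)^2 * (y + I) * (y - I) * b2
  rw [DD, GG, e1, e2]; ring

lemma exp_image : (fun x : ℝ => Real.exp x) '' univ = Ioi 0 := by
  rw [image_univ]; exact Real.range_exp

lemma neg_exp_image : (fun x : ℝ => -Real.exp x) '' univ = Iio 0 := by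
  have : (fun x : ℝ => -Real.exp x) = Neg.neg ∘ Real.exp := rfl
  rw [this, image_comp, image_univ, Real.range_exp]
  simp

lemma DD_pos : IntegrableOn DD (Ioi 0) ∧ ∫ y in Ioi 0, DD y = ∫ x : ℝ, GG x := by
  have hd : ∀ x ∈ (univ : Set ℝ), HasDerivWithinAt (fun x : ℝ => Real.exp x) (Real.exp x) univ x :=
    fun x _ => (Real.hasDerivAt_exp x).hasDerivWithinAt
  have hi : InjOn (fun x : ℝ => Real.exp x) univ := Real.exp_injective.injOn
  have he : (fun x : ℝ => |Real.exp x| • DD (Real.exp x)) =ᵐ[volume] fun x : ℝ => GG x := by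
    have hne : ∀ᵐ x : ℝ, x ≠ 0 := by simp [ae_iff]
    filter_upwards [hne] with x hx
    rw [abs_of_pos (Real.exp_pos x), Complex.real_smul]
    refine DD_eq _ _ (by exact_mod_cast hx) ?_ (by simp)
    rw [← Complex.ofReal_log (Real.exp_pos x).le, Real.log_exp]
  have hG : Integrable (fun x : ℝ => GG x) := by
    have := GG_integrable 0 (by simp) (by simp; norm_num)
    simpa using this
  rw [← exp_image]
  constructor
  · rw [integrableOn_image_iff_integrableOn_abs_deriv_smul MeasurableSet.univ hd hi, integrableOn_univ]
    exact hG.congr he.symm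
  · rw [integral_image_eq_integral_abs_deriv_smul MeasurableSet.univ hd hi, setIntegral_univ]
    exact integral_congr_ae he

lemma DD_neg : IntegrableOn DD (Iio 0) ∧ ∫ y in Iio 0, DD y = - ∫ x : ℝ, GG (x + (π : ℝ) * I) := by
  have hd : ∀ x ∈ (univ : Set ℝ), HasDerivWithinAt (fun x : ℝ => -Real.exp x) (-Real.exp x) univ x :=
    fun x _ => (Real.hasDerivAt_exp x).neg.hasDerivWithinAt
  have hi : InjOn (fun x : ℝ => -Real.exp x) univ := (neg_injective.comp Real.exp_injective).injOn
  have he : ∀ x : ℝ, |-Real.exp x| • DD (-Real.exp x) = - GG (x + (π : ℝ) * I) := by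
    intro x
    rw [abs_neg, abs_of_pos (Real.exp_pos x), Complex.real_smul, ← DD_eq (-Real.exp x)]
    · push_cast; ring
    · intro h
      have := congrArg Complex.im h
      simp [Real.pi_ne_zero] at this
    · apply Complex.ext
      · simp [Complex.log_re]
      · rw [Complex.log_im, Complex.arg_ofReal_of_neg (by simpa using Real.exp_pos x)]
        simp
    · rw [Complex.exp_add, Complex.exp_pi_mul_I]
      push_cast; ring
  have hG := GG_integrable π (by simp) (by simp; norm_num)
  rw [← neg_exp_image]
  constructor
  · rw [integrableOn_image_iff_integrableOn_abs_deriv_smul MeasurableSet.univ hd hi, integrableOn_univ]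
    simp only [he]
    exact hG.neg
  · rw [integral_image_eq_integral_abs_deriv_smul MeasurableSet.univ hd hi, setIntegral_univ]
    simp only [he]
    exact integral_neg _

lemma FF_integral : ∫ y, FF y = gg pp * (I * π / 2) := by
  obtain ⟨a1, a2⟩ := DD_pos
  obtain ⟨b1, b2⟩ := DD_neg
  have b3 : IntegrableOn DD (Iic 0) := (integrableOn_Iic_iff_integrableOn_Iio).2 b1
  have hD : Integrable DD := by
    rw [← integrableOn_univ, ← Iic_union_Ioi (a := (0:ℝ)), integrableOn_union]
    exact ⟨b3, a1⟩
  have h0 : ∫ y, DD y = 0 := by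
    rw [← intervalIntegral.integral_Iic_add_Ioi b3 a1, integral_Iic_eq_integral_Iio, a2, b2, boundary_eq]
    ring
  have : ∀ y, FF y = DD y + gg pp * PP y := fun y => by rw [DD]; ring
  simp only [this]
  rw [integral_add hD (PP_integrable.const_mul _), h0, integral_const_mul, PP_integral, zero_add]

lemma final_const : gg pp * (I * π / 2) =
    Complex.exp (I * π / 4) * (Real.sqrt (π / 2) : ℂ) * Complex.log (I * π / 2) := by
  have hl : Complex.log pp = (Real.log (π / 2) : ℝ) + (π / 2 : ℂ) * I := by
    have h := Complex.log_ofReal_mul (r := π / 2) (by positivity) Complex.I_ne_zero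
    rw [Complex.log_I] at h
    rw [← h, pp]; congr 1; push_cast; ring
  have hs : Complex.exp ((1/2) * Complex.log pp) = Complex.exp (I * π / 4) * (Real.sqrt (π / 2) : ℂ) := by
    rw [hl, Real.sqrt_eq_rpow, Real.rpow_def_of_pos (by positivity), Complex.ofReal_exp, ← Complex.exp_add]
    congr 1; push_cast; ring
  have hp : pp ≠ 0 := by simp [pp, Real.pi_ne_zero]
  have h2 : pp = Complex.exp ((1/2) * Complex.log pp) * Complex.exp ((1/2) * Complex.log pp) := by
    rw [← Complex.exp_add, ← add_mul]; norm_num [Complex.exp_log hp]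
  rw [← hs]
  change gg pp * pp = _ * Complex.log pp
  rw [gg, neg_mul, Complex.exp_neg]
  have he := Complex.exp_ne_zero ((1/2) * Complex.log pp)
  calc _ = Complex.log pp * (Complex.exp ((1/2) * Complex.log pp))⁻¹ * (Complex.exp ((1/2) * Complex.log pp) * Complex.exp ((1/2) * Complex.log pp)) := by rw [← h2]
    _ = _ := by field_simp

theorem example_six :
    ∫ y : ℝ, (y : ℂ) * Complex.log (Complex.log y) /
        ((1 - I * y) * ((y : ℂ) ^ 2 + 1) * (Complex.log y) ^ ((1 : ℂ) / 2)) =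
      Complex.exp (I * π / 4) * (Real.sqrt (π / 2) : ℂ) * Complex.log (I * π / 2) := by
  have h := FF_integral
  rw [final_const] at h
  exact h
end
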